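/- Let n = 1, let F : ℝ×ℝᵐ → ℝ be continuously differentiable and f, g : ℝ×ℝᵐ three times continuously differentiable. Let ȳ ∈ Y(x̄) be a nondegenerate critical point of L(x̄) (ND1–ND3) with multiplier ū (extended by zero outside J₀ := J₀(x̄,ȳ)). Then the following two conditions are equivalent: (a) there exist w ∈ ℝᵐ and ξ ∈ ℝᵖ with 0 = ∇_x F(x̄,ȳ) − [∇²_{xy}(f + ūᵀg)(x̄,ȳ)]w + ∇_x(ξᵀg)(x̄,ȳ), 0 = ∇_y F(x̄,ȳ) − [∇²_{yy}(f + ūᵀg)(x̄,ȳ)]w + ∇_y(ξᵀg)(x̄,ȳ), ξ_i = 0 for all i ∉ J₀, and ⟨∇_y g_j(x̄,ȳ), w⟩ = 0 for all j ∈ J₀; (b) there exist C² mappings y(x) ∈ ℝᵐ and u_j(x) (j ∈ J₀), defined on a neighborhood of x̄, with y(x̄) = ȳ and u_j(x̄) = ū_j, satisfying ∇_y f(x, y(x)) + Σ_{j∈J₀} u_j(x) ∇_y g_j(x, y(x)) = 0 and g_j(x, y(x)) = 0 for all j ∈ J₀ on that neighborhood, such that ∇_x F(x̄,ȳ) + ⟨∇_y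 F(x̄,ȳ), D_x y(x̄)⟩ = 0. -/

import Mathlib

open scoped RealInnerProductSpace Classical
open Topology

noncomputable section

/-- The partial gradient `∇_y f (x,y)` (upper-level variable one-dimensional). -/
def gradY {m : ℕ} (f : ℝ × EuclideanSpace ℝ (Fin m) → ℝ)
    (x : ℝ) (y : EuclideanSpace ℝ (Fin m)) : EuclideanSpace ℝ (Fin m) :=
  gradient (fun y' => f (x, y')) y

/-- The partial gradient `∇_y g_j (x,y)`. -/
def gradYg {m p : ℕ} (g : ℝ × EuclideanSpace ℝ (Fin m) → Fin p → ℝ)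
    (x : ℝ) (y : EuclideanSpace ℝ (Fin m)) (j : Fin p) : EuclideanSpace ℝ (Fin m) :=
  gradient (fun y' => g (x, y') j) y

/-- The lower-level Lagrangian `f + ūᵀ g`. -/
def Lag {m p : ℕ} (f : ℝ × EuclideanSpace ℝ (Fin m) → ℝ)
    (g : ℝ × EuclideanSpace ℝ (Fin m) → Fin p → ℝ) (u : Fin p → ℝ) :
    ℝ × EuclideanSpace ℝ (Fin m) → ℝ :=
  fun z => f z + ∑ j, u j * g z j

/-- The Hessian block `∇²_{yy}(f + ūᵀg)(x̄,ȳ)` as a continuous linear map. -/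
def LagYY {m p : ℕ} (f : ℝ × EuclideanSpace ℝ (Fin m) → ℝ)
    (g : ℝ × EuclideanSpace ℝ (Fin m) → Fin p → ℝ) (u : Fin p → ℝ)
    (x : ℝ) (y : EuclideanSpace ℝ (Fin m)) :
    EuclideanSpace ℝ (Fin m) →L[ℝ] EuclideanSpace ℝ (Fin m) :=
  fderiv ℝ (fun y' => gradY (Lag f g u) x y') y

/-- The mixed second-derivative block `∇²_{xy}(f + ūᵀg)(x̄,ȳ)` (a vector, since `n = 1`). -/
def LagMix {m p : ℕ} (f : ℝ × EuclideanSpace ℝ (Fin m) → ℝ)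
    (g : ℝ × EuclideanSpace ℝ (Fin m) → Fin p → ℝ) (u : Fin p → ℝ)
    (x : ℝ) (y : EuclideanSpace ℝ (Fin m)) : EuclideanSpace ℝ (Fin m) :=
  deriv (fun x' => gradY (Lag f g u) x' y) x

section helpers17

lemma gradY_inner {m : ℕ} {f : ℝ × EuclideanSpace ℝ (Fin m) → ℝ} (hf : Differentiable ℝ f)
    (x : ℝ) (y v : EuclideanSpace ℝ (Fin m)) :
    ⟪gradY f x y, v⟫ = fderiv ℝ f (x, y) (0, v) := by
  have h : HasFDerivAt (fun y' => f (x, y'))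
      ((fderiv ℝ f (x, y)).comp (ContinuousLinearMap.inr ℝ ℝ (EuclideanSpace ℝ (Fin m)))) y :=
    (hf (x, y)).hasFDerivAt.comp y (hasFDerivAt_prodMk_right x y)
  unfold gradY gradient
  rw [InnerProductSpace.toDual_symm_apply, h.fderiv]
  simp

lemma gradY_eq {m : ℕ} {f : ℝ × EuclideanSpace ℝ (Fin m) → ℝ} (hf : Differentiable ℝ f) :
    (fun z : ℝ × EuclideanSpace ℝ (Fin m) => gradY f z.1 z.2) = fun z =>
      (InnerProductSpace.toDual ℝ (EuclideanSpace ℝ (Fin m))).symm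
        ((fderiv ℝ f z).comp (ContinuousLinearMap.inr ℝ ℝ (EuclideanSpace ℝ (Fin m)))) := by
  funext z
  refine ext_inner_right ℝ fun v => ?_
  rw [gradY_inner hf, InnerProductSpace.toDual_symm_apply]
  simp

lemma gradY_contDiff {m : ℕ} {f : ℝ × EuclideanSpace ℝ (Fin m) → ℝ} (hf : ContDiff ℝ 3 f) :
    ContDiff ℝ 2 (fun z : ℝ × EuclideanSpace ℝ (Fin m) => gradY f z.1 z.2) := by
  rw [gradY_eq (hf.differentiable (by norm_num))]
  have h1 : ContDiff ℝ 2 (fderiv ℝ f) := hf.fderiv_right (by norm_num)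
  have h2 : ContDiff ℝ 2 (fun z => (fderiv ℝ f z).comp
      (ContinuousLinearMap.inr ℝ ℝ (EuclideanSpace ℝ (Fin m)))) :=
    h1.clm_comp contDiff_const
  exact (InnerProductSpace.toDual ℝ (EuclideanSpace ℝ (Fin m))).symm.contDiff.comp h2

lemma gradY_symm {m : ℕ} {f : ℝ × EuclideanSpace ℝ (Fin m) → ℝ} (hf : ContDiff ℝ 3 f)
    (x : ℝ) (y v w : EuclideanSpace ℝ (Fin m)) :
    ⟪fderiv ℝ (fun y' => gradY f x y') y v, w⟫ = ⟪fderiv ℝ (fun y' => gradY f x y') y w, v⟫ := by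
  have hl : ContDiff ℝ 3 (fun y' => f (x, y')) := hf.comp (contDiff_prodMk_right x)
  have hs : IsSymmSndFDerivAt ℝ (fun y' => f (x, y')) y :=
    hl.contDiffAt.isSymmSndFDerivAt (by simp; norm_num)
  have hd : DifferentiableAt ℝ (fderiv ℝ (fun y' => f (x, y'))) y :=
    (hl.fderiv_right (m := 2) (by norm_num)).differentiable (by norm_num) y
  have key : ∀ v w, ⟪fderiv ℝ (fun y' => gradY f x y') y v, w⟫
      = fderiv ℝ (fderiv ℝ (fun y' => f (x, y'))) y v w := by
    intro v w
    have hG : DifferentiableAt ℝ (fun y' => gradY f x y') y :=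
      ((gradY_contDiff hf).comp (contDiff_prodMk_right x)).differentiable (by norm_num) y
    have h1 : HasFDerivAt (fun y' => ⟪w, gradY f x y'⟫)
        ((innerSL ℝ w).comp (fderiv ℝ (fun y' => gradY f x y') y)) y :=
      (innerSL ℝ w).hasFDerivAt.comp y hG.hasFDerivAt
    have h2 : HasFDerivAt (fun y' => fderiv ℝ (fun y' => f (x, y')) y' w)
        ((ContinuousLinearMap.apply ℝ ℝ w).comp
          (fderiv ℝ (fderiv ℝ (fun y' => f (x, y'))) y)) y :=
      (ContinuousLinearMap.apply ℝ ℝ w).hasFDerivAt.comp y hd.hasFDerivAt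
    have h3 : (fun y' => ⟪w, gradY f x y'⟫) = fun y' => fderiv ℝ (fun y' => f (x, y')) y' w := by
      funext y'
      rw [real_inner_comm]
      exact InnerProductSpace.toDual_symm_apply
    rw [h3] at h1
    have h4 := congrArg (fun T => T v) (h1.unique h2)
    rw [real_inner_comm]
    simpa using h4
  rw [key, key]
  exact hs v w

lemma gradY_Lag {m p : ℕ} {f : ℝ × EuclideanSpace ℝ (Fin m) → ℝ}
    {g : ℝ × EuclideanSpace ℝ (Fin m) → Fin p → ℝ}
    (hf : Differentiable ℝ f) (hg : ∀ j, Differentiable ℝ (fun z => g z j)) (u : Fin p → ℝ)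
    (x : ℝ) (y : EuclideanSpace ℝ (Fin m)) :
    gradY (Lag f g u) x y = gradY f x y + ∑ j, u j • gradYg g x y j := by
  have hL : HasFDerivAt (Lag f g u)
      (fderiv ℝ f (x, y) + ∑ j, u j • fderiv ℝ (fun z => g z j) (x, y)) (x, y) := by
    unfold Lag
    exact (hf _).hasFDerivAt.add (HasFDerivAt.fun_sum fun j _ => ((hg j _).hasFDerivAt.const_mul (u j)))
  have hLd : Differentiable ℝ (Lag f g u) := by
    unfold Lag
    exact hf.add (Differentiable.fun_sum fun j _ => (hg j).const_mul (u j))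
  refine ext_inner_right ℝ fun v => ?_
  rw [gradY_inner hLd, hL.fderiv, inner_add_left, gradY_inner hf, sum_inner]
  simp only [add_apply, sum_apply,
    smul_apply, inner_smul_left]
  congr 1
  refine Finset.sum_congr rfl fun j _ => ?_
  have := gradY_inner (hg j) x y v
  simp only [smul_eq_mul, conj_trivial]
  rw [← this]; rfl

lemma gradY_sum {m p : ℕ}
    {g : ℝ × EuclideanSpace ℝ (Fin m) → Fin p → ℝ}
    (hg : ∀ j, Differentiable ℝ (fun z => g z j)) (u : Fin p → ℝ)
    (x : ℝ) (y : EuclideanSpace ℝ (Fin m)) :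
    gradY (fun z => ∑ j, u j * g z j) x y = ∑ j, u j • gradYg g x y j := by
  have h := gradY_Lag (f := fun _ => 0) (differentiable_const 0) hg u x y
  have h0 : gradY (fun _ : ℝ × EuclideanSpace ℝ (Fin m) => (0:ℝ)) x y = 0 := by
    unfold gradY; simp
  rw [h0, zero_add] at h
  rw [← h]; unfold Lag; simp

/-- The KKT map. -/
def HH {E : Type*} [NormedAddCommGroup E] [NormedSpace ℝ E] {p : ℕ} (Lg : ℝ × E → E)
    (A : Fin p → ℝ × E → E) (g : ℝ × E → Fin p → ℝ) (S : Fin p → Prop) (ub : Fin p → ℝ)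
    (z : ℝ × (E × (Fin p → ℝ))) : E × (Fin p → ℝ) :=
  (Lg (z.1, z.2.1) + ∑ j, (z.2.2 j - ub j) • A j (z.1, z.2.1),
    fun j => if S j then g (z.1, z.2.1) j else z.2.2 j - ub j)

lemma HH_contDiff {E : Type*} [NormedAddCommGroup E] [NormedSpace ℝ E] {p : ℕ} {Lg : ℝ × E → E}
    {A : Fin p → ℝ × E → E} {g : ℝ × E → Fin p → ℝ} (S : Fin p → Prop) (ub : Fin p → ℝ)
    (hLg : ContDiff ℝ 2 Lg) (hA : ∀ j, ContDiff ℝ 2 (A j))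
    (hg : ∀ j, ContDiff ℝ 2 (fun z => g z j)) : ContDiff ℝ 2 (HH Lg A g S ub) := by
  have hP : ContDiff ℝ 2 (fun z : ℝ × (E × (Fin p → ℝ)) => (z.1, z.2.1)) := by fun_prop
  have hu : ∀ j, ContDiff ℝ 2 (fun z : ℝ × (E × (Fin p → ℝ)) => z.2.2 j - ub j) := by
    intro j; fun_prop
  refine ContDiff.prodMk ?_ ?_
  · exact (hLg.comp hP).add (ContDiff.sum fun j _ => (hu j).smul ((hA j).comp hP))
  · refine contDiff_pi.2 fun j => ?_
    by_cases h : S j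
    · simp only [h, if_true]; exact (hg j).comp hP
    · simp only [h, if_false]; exact hu j

lemma HH_fderiv {E : Type*} [NormedAddCommGroup E] [NormedSpace ℝ E] {p : ℕ} {Lg : ℝ × E → E}
    {A : Fin p → ℝ × E → E} {g : ℝ × E → Fin p → ℝ} (S : Fin p → Prop) (ub : Fin p → ℝ)
    (hLg : Differentiable ℝ Lg) (hA : ∀ j, Differentiable ℝ (A j))
    (hg : ∀ j, Differentiable ℝ (fun z => g z j)) (x : ℝ) (y : E) (t : ℝ) (v : E)
    (μ : Fin p → ℝ) :
    fderiv ℝ (HH Lg A g S ub) (x, y, ub) (t, v, μ) =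
      (fderiv ℝ Lg (x, y) (t, v) + ∑ j, μ j • A j (x, y),
        fun j => if S j then fderiv ℝ (fun z => g z j) (x, y) (t, v) else μ j) := by
  set P : ℝ × (E × (Fin p → ℝ)) →L[ℝ] ℝ × E := (ContinuousLinearMap.fst ℝ _ _).prod
    ((ContinuousLinearMap.fst ℝ _ _).comp (ContinuousLinearMap.snd ℝ _ _)) with hPdef
  set Q : Fin p → ℝ × (E × (Fin p → ℝ)) →L[ℝ] ℝ := fun j =>
    (ContinuousLinearMap.proj (R := ℝ) (φ := fun _ : Fin p => ℝ) j).comp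
    ((ContinuousLinearMap.snd ℝ _ _).comp (ContinuousLinearMap.snd ℝ _ _)) with hQdef
  have hP : HasFDerivAt (fun z : ℝ × (E × (Fin p → ℝ)) => (z.1, z.2.1)) P (x, y, ub) :=
    P.hasFDerivAt
  have hQ : ∀ j, HasFDerivAt (fun z : ℝ × (E × (Fin p → ℝ)) => z.2.2 j - ub j) (Q j)
      (x, y, ub) := fun j => (Q j).hasFDerivAt.sub_const _
  have h1 : HasFDerivAt (fun z : ℝ × (E × (Fin p → ℝ)) => Lg (z.1, z.2.1))
      ((fderiv ℝ Lg (x, y)).comp P) (x, y, ub) :=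
    HasFDerivAt.comp (x, y, ub) (f := fun z : ℝ × (E × (Fin p → ℝ)) => (z.1, z.2.1))
      (hLg (x, y)).hasFDerivAt hP
  have h2 : ∀ j, HasFDerivAt (fun z : ℝ × (E × (Fin p → ℝ)) => A j (z.1, z.2.1))
      ((fderiv ℝ (A j) (x, y)).comp P) (x, y, ub) := fun j =>
    HasFDerivAt.comp (x, y, ub) (f := fun z : ℝ × (E × (Fin p → ℝ)) => (z.1, z.2.1))
      (hA j (x, y)).hasFDerivAt hP
  have h3 : ∀ j, HasFDerivAt (fun z : ℝ × (E × (Fin p → ℝ)) => g (z.1, z.2.1) j)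
      ((fderiv ℝ (fun z => g z j) (x, y)).comp P) (x, y, ub) := fun j =>
    HasFDerivAt.comp (x, y, ub) (f := fun z : ℝ × (E × (Fin p → ℝ)) => (z.1, z.2.1))
      (g := fun z => g z j) (hg j (x, y)).hasFDerivAt hP
  have h4 := h1.add (HasFDerivAt.fun_sum (u := Finset.univ) fun j _ => (hQ j).smul (h2 j))
  have h5 : HasFDerivAt (fun z : ℝ × (E × (Fin p → ℝ)) =>
      (fun j => if S j then g (z.1, z.2.1) j else z.2.2 j - ub j))
      (ContinuousLinearMap.pi fun j => if S j then (fderiv ℝ (fun z => g z j) (x, y)).comp P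
        else Q j) (x, y, ub) := by
    refine hasFDerivAt_pi.2 fun j => ?_
    by_cases h : S j
    · simp only [h, if_true]; exact h3 j
    · simp only [h, if_false]; exact hQ j
  have h6 : HasFDerivAt (HH Lg A g S ub) _ (x, y, ub) := h4.prodMk h5
  rw [h6.fderiv]
  ext j
  · simp [hPdef, hQdef]
  · by_cases h : S j <;> simp [h, hPdef, hQdef]

end helpers17

theorem statement17 {m p : ℕ}
    (F f : ℝ × EuclideanSpace ℝ (Fin m) → ℝ)
    (g : ℝ × EuclideanSpace ℝ (Fin m) → Fin p → ℝ)
    (hF : ContDiff ℝ 1 F) (hf : ContDiff ℝ 3 f) (hg : ContDiff ℝ 3 g)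
    (xbar : ℝ) (ybar : EuclideanSpace ℝ (Fin m))
    (hfeas : ∀ j, g (xbar, ybar) j ≤ 0)
    (ubar : Fin p → ℝ)
    (husupp : ∀ j, g (xbar, ybar) j ≠ 0 → ubar j = 0)
    -- ND1 (LICQ) and the multiplier rule
    (hLICQ : LinearIndependent ℝ
      (fun j : {j : Fin p // g (xbar, ybar) j = 0} => gradYg g xbar ybar j.1))
    (hstat : gradY f xbar ybar + ∑ j, ubar j • gradYg g xbar ybar j = 0)
    -- ND2 (strict complementarity)
    (hSC : ∀ j, g (xbar, ybar) j = 0 → ubar j ≠ 0)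
    -- ND3 (second-order condition)
    (hSOC : ∀ w : EuclideanSpace ℝ (Fin m),
      (∀ j, g (xbar, ybar) j = 0 → ⟪gradYg g xbar ybar j, w⟫ = 0) →
      (∀ v : EuclideanSpace ℝ (Fin m),
        (∀ j, g (xbar, ybar) j = 0 → ⟪gradYg g xbar ybar j, v⟫ = 0) →
        ⟪LagYY f g ubar xbar ybar w, v⟫ = 0) →
      w = 0) :
    -- (a) the explicit optimality condition
    (∃ (w : EuclideanSpace ℝ (Fin m)) (ξ : Fin p → ℝ),
      0 = deriv (fun x => F (x, ybar)) xbar - ⟪LagMix f g ubar xbar ybar, w⟫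
          + deriv (fun x => ∑ i, ξ i * g (x, ybar) i) xbar ∧
      (0 : EuclideanSpace ℝ (Fin m))
        = gradY F xbar ybar - LagYY f g ubar xbar ybar w
          + gradY (fun z => ∑ i, ξ i * g z i) xbar ybar ∧
      (∀ i, g (xbar, ybar) i ≠ 0 → ξ i = 0) ∧
      (∀ j, g (xbar, ybar) j = 0 → ⟪gradYg g xbar ybar j, w⟫ = 0))
    ↔
    -- (b) the implicit optimality condition of Jongen–Shikhman
    (∃ (U : Set ℝ) (ycurve : ℝ → EuclideanSpace ℝ (Fin m)) (ucurve : Fin p → ℝ → ℝ),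
      U ∈ 𝓝 xbar ∧
      ContDiffOn ℝ 2 ycurve U ∧
      (∀ j, g (xbar, ybar) j = 0 → ContDiffOn ℝ 2 (ucurve j) U) ∧
      ycurve xbar = ybar ∧
      (∀ j, g (xbar, ybar) j = 0 → ucurve j xbar = ubar j) ∧
      (∀ x ∈ U,
        gradY f x (ycurve x)
          + ∑ j, (if g (xbar, ybar) j = 0 then ucurve j x else 0)
              • gradYg g x (ycurve x) j = 0 ∧
        ∀ j, g (xbar, ybar) j = 0 → g (x, ycurve x) j = 0) ∧
      deriv (fun x => F (x, ybar)) xbar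
        + ⟪gradY F xbar ybar, deriv ycurve xbar⟫ = 0) := by
  have hgj : ∀ j, ContDiff ℝ 3 (fun z => g z j) := fun j => contDiff_pi.1 hg j
  have hgd : ∀ j, Differentiable ℝ (fun z => g z j) := fun j =>
    (hgj j).differentiable (by norm_num)
  have hfd : Differentiable ℝ f := hf.differentiable (by norm_num)
  have hLag : ContDiff ℝ 3 (Lag f g ubar) := by
    unfold Lag
    exact hf.add (ContDiff.sum fun j _ => contDiff_const.mul (hgj j))
  set Lg : ℝ × EuclideanSpace ℝ (Fin m) → EuclideanSpace ℝ (Fin m) :=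
    fun z => gradY (Lag f g ubar) z.1 z.2 with hLgdef
  set A : Fin p → ℝ × EuclideanSpace ℝ (Fin m) → EuclideanSpace ℝ (Fin m) :=
    fun j z => gradYg g z.1 z.2 j with hAdef
  have hLg : ContDiff ℝ 2 Lg := gradY_contDiff hLag
  have hA : ∀ j, ContDiff ℝ 2 (A j) := fun j => gradY_contDiff (hgj j)
  have hLgd : Differentiable ℝ Lg := hLg.differentiable (by norm_num)
  have hAd : ∀ j, Differentiable ℝ (A j) := fun j => (hA j).differentiable (by norm_num)
  set S : Fin p → Prop := fun j => g (xbar, ybar) j = 0 with hSdef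
  have hH : ContDiff ℝ 2 (HH Lg A g S ubar) :=
    HH_contDiff S ubar hLg hA (fun j => (hgj j).of_le (by norm_num))
  have hHfd := HH_fderiv S ubar hLgd hAd hgd xbar ybar
  have hYY : ∀ v, LagYY f g ubar xbar ybar v = fderiv ℝ Lg (xbar, ybar) (0, v) := by
    intro v
    have h : HasFDerivAt (fun y' => Lg (xbar, y')) ((fderiv ℝ Lg (xbar, ybar)).comp
        (ContinuousLinearMap.inr ℝ ℝ (EuclideanSpace ℝ (Fin m)))) ybar :=
      (hLgd (xbar, ybar)).hasFDerivAt.comp ybar (hasFDerivAt_prodMk_right xbar ybar)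
    have h' : LagYY f g ubar xbar ybar = _ := h.fderiv
    rw [h']; simp
  have hsec : ∀ (φ : ℝ × EuclideanSpace ℝ (Fin m) → ℝ), Differentiable ℝ φ →
      HasDerivAt (fun x => φ (x, ybar)) (fderiv ℝ φ (xbar, ybar) (1, 0)) xbar := by
    intro φ hφ
    have h : HasFDerivAt (fun x => φ (x, ybar)) ((fderiv ℝ φ (xbar, ybar)).comp
        (ContinuousLinearMap.inl ℝ ℝ (EuclideanSpace ℝ (Fin m)))) xbar :=
      (hφ (xbar, ybar)).hasFDerivAt.comp xbar (hasFDerivAt_prodMk_left xbar ybar)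
    simpa using h.hasDerivAt
  have hMix : LagMix f g ubar xbar ybar = fderiv ℝ Lg (xbar, ybar) (1, 0) := by
    have h : HasFDerivAt (fun x => Lg (x, ybar)) ((fderiv ℝ Lg (xbar, ybar)).comp
        (ContinuousLinearMap.inl ℝ ℝ (EuclideanSpace ℝ (Fin m)))) xbar :=
      HasFDerivAt.comp (f := fun x : ℝ => (x, ybar)) (g := Lg) xbar
        (hLgd (xbar, ybar)).hasFDerivAt (hasFDerivAt_prodMk_left (𝕜 := ℝ) xbar ybar)
    have h' : LagMix f g ubar xbar ybar = _ := h.hasDerivAt.deriv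
    rw [h']; simp
  have hsymm : ∀ v w, ⟪LagYY f g ubar xbar ybar v, w⟫ = ⟪LagYY f g ubar xbar ybar w, v⟫ :=
    fun v w => gradY_symm hLag xbar ybar v w
  have hginner : ∀ j v, fderiv ℝ (fun z => g z j) (xbar, ybar) (0, v)
      = ⟪gradYg g xbar ybar j, v⟫ := fun j v => (gradY_inner (hgd j) xbar ybar v).symm
  -- the partial derivative
  set K : (EuclideanSpace ℝ (Fin m) × (Fin p → ℝ)) →L[ℝ] (EuclideanSpace ℝ (Fin m) × (Fin p → ℝ)) :=
    (fderiv ℝ (HH Lg A g S ubar) (xbar, ybar, ubar)).comp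
      (ContinuousLinearMap.inr ℝ ℝ (EuclideanSpace ℝ (Fin m) × (Fin p → ℝ))) with hKdef
  have hK : ∀ v μ, K (v, μ) = (LagYY f g ubar xbar ybar v + ∑ j, μ j • gradYg g xbar ybar j,
      fun j => if S j then ⟪gradYg g xbar ybar j, v⟫ else μ j) := by
    intro v μ
    have := hHfd 0 v μ
    simp only [hginner, ← hYY] at this
    exact this
  have hKinj : Function.Injective K := by
    rw [injective_iff_map_eq_zero]
    rintro ⟨v, μ⟩ h0
    rw [hK, Prod.mk_eq_zero] at h0
    obtain ⟨h1, h2⟩ := h0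
    have hμ : ∀ j, ¬ S j → μ j = 0 := by
      intro j hj
      have := congrFun h2 j
      simpa [hj] using this
    have hv : ∀ j, S j → ⟪gradYg g xbar ybar j, v⟫ = 0 := by
      intro j hj
      have := congrFun h2 j
      simpa [hj] using this
    have hv0 : v = 0 := by
      refine hSOC v hv fun v' hv' => ?_
      rw [eq_neg_of_add_eq_zero_left h1, inner_neg_left, sum_inner, neg_eq_zero]
      refine Finset.sum_eq_zero fun j _ => ?_
      rw [inner_smul_left]
      by_cases hj : S j
      · rw [hv' j hj, mul_zero]
      · rw [hμ j hj]; simp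
    subst hv0
    rw [map_zero, zero_add] at h1
    have h3 : ∑ j : {j : Fin p // S j}, μ j.1 • gradYg g xbar ybar j.1 = 0 := by
      rw [← h1]
      rw [← Finset.sum_subtype (Finset.univ.filter S) (by simp)
        (fun j => μ j • gradYg g xbar ybar j), Finset.sum_filter]
      refine Finset.sum_congr rfl fun j _ => ?_
      by_cases hj : S j
      · rw [if_pos hj]
      · rw [if_neg hj, hμ j hj, zero_smul]
    have h4 := Fintype.linearIndependent_iff.1 hLICQ (fun j => μ j.1) h3
    rw [Prod.mk_eq_zero]
    refine ⟨rfl, funext fun j => ?_⟩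
    by_cases hj : S j
    · exact h4 ⟨j, hj⟩
    · exact hμ j hj
  have hKsurj : Function.Surjective K := LinearMap.surjective_of_injective (f := K.toLinearMap) hKinj
  have hKinv : K.IsInvertible :=
    ⟨(LinearEquiv.ofBijective K.toLinearMap ⟨hKinj, hKsurj⟩).toContinuousLinearEquiv, by ext <;> rfl⟩
  -- KKT map in terms of f, g
  have hHH : ∀ x y u, HH Lg A g S ubar (x, y, u) = 0 ↔
      (gradY f x y + ∑ j, u j • gradYg g x y j = 0 ∧ (∀ j, S j → g (x, y) j = 0) ∧
        ∀ j, ¬ S j → u j = 0) := by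
    intro x y u
    have e : Lg (x, y) + ∑ j, (u j - ubar j) • A j (x, y)
        = gradY f x y + ∑ j, u j • gradYg g x y j := by
      simp only [hLgdef, hAdef]
      rw [gradY_Lag hfd hgd, add_assoc, ← Finset.sum_add_distrib]
      congr 1
      refine Finset.sum_congr rfl fun j _ => ?_
      rw [← add_smul]; congr 1; ring
    unfold HH
    simp only
    rw [Prod.mk_eq_zero, e]
    refine and_congr Iff.rfl ⟨fun h => ⟨fun j hj => ?_, fun j hj => ?_⟩, fun h => ?_⟩
    · have := congrFun h j
      simpa [hj] using this
    · have := congrFun h j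
      have h0 := husupp j hj
      simpa [hj, h0] using this
    · funext j
      by_cases hj : S j
      · simpa [hj] using h.1 j hj
      · have h0 := husupp j hj
        simpa [hj, h0] using h.2 j hj
  have hbase : HH Lg A g S ubar (xbar, ybar, ubar) = 0 :=
    (hHH _ _ _).2 ⟨hstat, fun j hj => hj, husupp⟩
  -- the adjoint system
  obtain ⟨w0, ξ0, hw0, hξ0, hwo0⟩ : ∃ (w : EuclideanSpace ℝ (Fin m)) (ξ : Fin p → ℝ),
      LagYY f g ubar xbar ybar w = gradY F xbar ybar + ∑ j, ξ j • gradYg g xbar ybar j ∧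
      (∀ j, ¬ S j → ξ j = 0) ∧ (∀ j, S j → ⟪gradYg g xbar ybar j, w⟫ = 0) := by
    obtain ⟨⟨w, ξ⟩, h⟩ := hKsurj (gradY F xbar ybar, 0)
    rw [hK, Prod.mk.injEq] at h
    refine ⟨w, fun j => - ξ j, ?_, fun j hj => ?_, fun j hj => ?_⟩
    · rw [← h.1]; simp
    · have := congrFun h.2 j
      simpa [hj] using this
    · have := congrFun h.2 j
      simpa [hj] using this
  have hcalc : ∀ (w : EuclideanSpace ℝ (Fin m)) (ξ : Fin p → ℝ),
      LagYY f g ubar xbar ybar w = gradY F xbar ybar + ∑ j, ξ j • gradYg g xbar ybar j →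
      (∀ j, ¬ S j → ξ j = 0) → (∀ j, S j → ⟪gradYg g xbar ybar j, w⟫ = 0) →
      ∀ (d : EuclideanSpace ℝ (Fin m)) (μ : Fin p → ℝ),
      fderiv ℝ (HH Lg A g S ubar) (xbar, ybar, ubar) (1, d, μ) = 0 →
      ⟪gradY F xbar ybar, d⟫ = - ⟪LagMix f g ubar xbar ybar, w⟫
          + deriv (fun x => ∑ i, ξ i * g (x, ybar) i) xbar := by
    intro w ξ hw hξ hwo d μ hd
    have hder : deriv (fun x => ∑ i, ξ i * g (x, ybar) i) xbar
        = ∑ i, ξ i * fderiv ℝ (fun z => g z i) (xbar, ybar) (1, 0) :=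
      (HasDerivAt.fun_sum fun i _ => (hsec _ (hgd i)).const_mul (ξ i)).deriv
    rw [hHfd, Prod.mk_eq_zero] at hd
    have hsplit : ((1 : ℝ), d) = (1, 0) + (0, d) := by simp
    rw [hsplit] at hd
    simp only [map_add, ← hYY, ← hMix, hginner] at hd
    obtain ⟨hd1, hd2⟩ := hd
    have hμ : ∀ j, ¬ S j → μ j = 0 := by
      intro j hj
      have := congrFun hd2 j
      simpa [hj] using this
    have hgd' : ∀ j, S j → ⟪gradYg g xbar ybar j, d⟫
        = - fderiv ℝ (fun z => g z j) (xbar, ybar) (1, 0) := by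
      intro j hj
      have := congrFun hd2 j
      simp only [hj, if_true, Pi.zero_apply] at this
      linarith
    have e1 := congrArg (fun q => ⟪q, d⟫) hw
    simp only [inner_add_left, sum_inner, inner_smul_left, conj_trivial] at e1
    have e2 := congrArg (fun q => ⟪q, w⟫) hd1
    simp only [inner_add_left, sum_inner, inner_smul_left, conj_trivial, inner_zero_left] at e2
    have e3 : ∑ j, μ j * ⟪A j (xbar, ybar), w⟫ = 0 := by
      refine Finset.sum_eq_zero fun j _ => ?_
      by_cases hj : S j
      · have := hwo j hj
        simp only [hAdef]; rw [this, mul_zero]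
      · rw [hμ j hj, zero_mul]
    have e4 : ∑ j, ξ j * ⟪gradYg g xbar ybar j, d⟫
        = - ∑ i, ξ i * fderiv ℝ (fun z => g z i) (xbar, ybar) (1, 0) := by
      rw [← Finset.sum_neg_distrib]
      refine Finset.sum_congr rfl fun j _ => ?_
      by_cases hj : S j
      · rw [hgd' j hj]; ring
      · rw [hξ j hj]; simp
    have e5 := hsymm w d
    rw [hder]
    linarith
  -- derivative along a curve
  have hcurve : ∀ (Y : ℝ → EuclideanSpace ℝ (Fin m)) (u : ℝ → Fin p → ℝ),
      DifferentiableAt ℝ Y xbar → DifferentiableAt ℝ u xbar → Y xbar = ybar → u xbar = ubar →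
      (∀ᶠ x in 𝓝 xbar, HH Lg A g S ubar (x, Y x, u x) = 0) →
      fderiv ℝ (HH Lg A g S ubar) (xbar, ybar, ubar) (1, deriv Y xbar, deriv u xbar) = 0 := by
    intro Y u hY hu hY0 hu0 hev
    have h1 : HasDerivAt (fun x => (x, Y x, u x)) (1, deriv Y xbar, deriv u xbar) xbar :=
      (hasDerivAt_id xbar).prodMk (hY.hasDerivAt.prodMk hu.hasDerivAt)
    have h2 : HasFDerivAt (HH Lg A g S ubar) (fderiv ℝ (HH Lg A g S ubar) (xbar, ybar, ubar))
        (xbar, Y xbar, u xbar) := by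
      rw [hY0, hu0]
      exact (hH.differentiable (by norm_num) _).hasFDerivAt
    have h3 := h2.comp_hasDerivAt xbar h1
    have h4 : HasDerivAt (HH Lg A g S ubar ∘ fun x => (x, Y x, u x)) 0 xbar :=
      (hasDerivAt_const xbar 0).congr_of_eventuallyEq hev
    exact h3.unique h4
  constructor
  · rintro ⟨w, ξ, ha1, ha2, ha3, ha4⟩
    rw [gradY_sum hgd] at ha2
    have cdf : ContDiffAt ℝ 2 (HH Lg A g S ubar) (xbar, ybar, ubar) := hH.contDiffAt
    set ψ := cdf.implicitFunction (by norm_num) hKinv with hψ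
    have p0 : ψ xbar = (ybar, ubar) := cdf.implicitFunction_apply_self (by norm_num) hKinv
    have p1 : ContDiffAt ℝ 2 ψ xbar := cdf.contDiffAt_implicitFunction (by norm_num) hKinv
    have p2 : ∀ᶠ x in 𝓝 xbar, HH Lg A g S ubar (x, ψ x) = 0 := by
      have := cdf.eventually_apply_implicitFunction (by norm_num) hKinv
      rw [hbase] at this
      exact this
    obtain ⟨V, hV, hVc⟩ := p1.contDiffOn (m := 2) le_rfl (by simp)
    have hVc : ContDiffOn ℝ 2 ψ V := by simpa using hVc
    have hV : V ∈ 𝓝 xbar := by simpa using hV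
    have d1 : DifferentiableAt ℝ ψ xbar := p1.differentiableAt (by norm_num)
    refine ⟨V ∩ {x | HH Lg A g S ubar (x, ψ x) = 0}, fun x => (ψ x).1, fun j x => (ψ x).2 j,
      Filter.inter_mem hV p2, ?_, ?_, ?_, ?_, ?_, ?_⟩
    · exact (hVc.fst).mono Set.inter_subset_left
    · intro j _
      exact (contDiffOn_pi.1 hVc.snd j).mono Set.inter_subset_left
    · simp only [p0]
    · intro j _; simp only [p0]
    · rintro x ⟨-, hx⟩
      obtain ⟨q1, q2, q3⟩ := (hHH x (ψ x).1 (ψ x).2).1 hx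
      refine ⟨?_, q2⟩
      rw [← q1]
      congr 1
      refine Finset.sum_congr rfl fun j _ => ?_
      by_cases hj : S j
      · rw [if_pos hj]
      · rw [if_neg hj, q3 j hj]
    · have h := hcurve (fun x => (ψ x).1) (fun x => (ψ x).2) d1.fst d1.snd (by simp only [p0])
        (by simp only [p0]) p2
      have h' := hcalc w ξ (by
        have := congrArg (fun q => q + LagYY f g ubar xbar ybar w) ha2
        simp only [zero_add] at this
        rw [this]; abel) ha3 ha4 _ _ h
      rw [h']; linarith
  · rintro ⟨U, Y, u, hU, hYc, huc, hY0, hu0, hEq, hb⟩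
    refine ⟨w0, ξ0, ?_, ?_, hξ0, hwo0⟩
    · have d1 : DifferentiableAt ℝ Y xbar :=
        (hYc.contDiffAt hU).differentiableAt (by norm_num)
      have d2 : DifferentiableAt ℝ (fun x j => if S j then u j x else 0) xbar := by
        refine differentiableAt_pi.2 fun j => ?_
        by_cases hj : S j
        · simp only [hj, if_true]
          exact ((huc j hj).contDiffAt hU).differentiableAt (by norm_num)
        · simp only [hj, if_false]
          exact differentiableAt_const 0
      have h := hcurve Y (fun x j => if S j then u j x else 0) d1 d2 hY0 (by
        funext j
        by_cases hj : S j
        · simp only [hj, if_true]; exact hu0 j hj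
        · simp only [hj, if_false]; exact (husupp j hj).symm) (by
        filter_upwards [hU] with x hx
        refine (hHH _ _ _).2 ⟨(hEq x hx).1, (hEq x hx).2, fun j hj => ?_⟩
        simp only [hj, if_false])
      have h' := hcalc w0 ξ0 hw0 hξ0 hwo0 _ _ h
      rw [h'] at hb
      linarith
    · rw [gradY_sum hgd, hw0]; abel
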